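/- arXiv:1912.05839 — 2 statements merged into one kernel-verified Lean document; each statement's English description precedes it below -/
import Mathlib

section
/- Let A₁ and A₂ be real symmetric square matrices of the same dimension, both having all diagonal entries equal to 1 and all off-diagonal entries nonpositive. Let μ₁ and μ₂ denote the smallest eigenvalues of A₁ and A₂, respectively. If A₁ ⪯ A₂ entrywise (i.e., (A₁)_{ij} ≤ (A₂)_{ij} for all i, j), then μ₁ ≤ μ₂. -/
open scoped Matrix MatrixOrder in
/-- The Rayleigh quotient of a real symmetric matrix is bounded below by any lower bound of its
eigenvalues. -/
theorem Matrix.IsHermitian.mul_dotProduct_self_le {ι : Type*} [Fintype ι] [DecidableEq ι]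
    {A : Matrix ι ι ℝ} (hA : A.IsHermitian) {c : ℝ} (hc : ∀ i, c ≤ hA.eigenvalues i)
    (x : ι → ℝ) : c * (x ⬝ᵥ x) ≤ x ⬝ᵥ A *ᵥ x := by
  have hle : algebraMap ℝ (Matrix ι ι ℝ) c ≤ A := by
    rw [algebraMap_le_iff_le_spectrum (ha := hA.isSelfAdjoint),
      hA.spectrum_real_eq_range_eigenvalues]
    rintro _ ⟨i, rfl⟩
    exact hc i
  have h := (Matrix.le_iff.mp hle).dotProduct_mulVec_nonneg x
  simpa [Algebra.algebraMap_eq_smul_one, Matrix.sub_mulVec, Matrix.smul_mulVec,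
    dotProduct_sub] using h

open scoped Matrix in
/-- If `A ≤ B` entrywise, with equal diagonals and nonpositive off-diagonal entries of `B`, then
the quadratic form of `A` at `|x|` is at most that of `B` at `x`. -/
theorem Matrix.abs_dotProduct_mulVec_abs_le {ι : Type*} [Fintype ι] {A B : Matrix ι ι ℝ}
    (hdiag : ∀ i, A i i = B i i) (hoff : ∀ i j, i ≠ j → B i j ≤ 0)
    (hle : ∀ i j, A i j ≤ B i j) (x : ι → ℝ) : |x| ⬝ᵥ A *ᵥ |x| ≤ x ⬝ᵥ B *ᵥ x := by
  simp only [dotProduct, Matrix.mulVec, Finset.mul_sum, Pi.abs_apply]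
  refine Finset.sum_le_sum fun i _ ↦ Finset.sum_le_sum fun j _ ↦ ?_
  rcases eq_or_ne i j with rfl | hij
  · rw [hdiag, mul_left_comm, abs_mul_abs_self, mul_left_comm]
  · calc |x i| * (A i j * |x j|) = A i j * |x i * x j| := by rw [abs_mul]; ring
      _ ≤ B i j * |x i * x j| := by gcongr; exact hle i j
      _ ≤ B i j * (x i * x j) := mul_le_mul_of_nonpos_left (le_abs_self _) (hoff i j hij)
      _ = x i * (B i j * x j) := by ring

/-- If `A₁, A₂` are real symmetric matrices with `1`'s on the diagonal and nonpositive
off-diagonal entries, and `A₁ ⪯ A₂` entrywise, then the smallest eigenvalue of `A₁` is at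
most the smallest eigenvalue of `A₂`. -/
theorem smallest_eigenvalue_monotone {n : ℕ} (A₁ A₂ : Matrix (Fin (n + 1)) (Fin (n + 1)) ℝ)
    (h₁ : A₁.IsHermitian) (h₂ : A₂.IsHermitian)
    (hd₁ : ∀ i, A₁ i i = 1) (hd₂ : ∀ i, A₂ i i = 1)
    (ho₁ : ∀ i j, i ≠ j → A₁ i j ≤ 0) (ho₂ : ∀ i j, i ≠ j → A₂ i j ≤ 0)
    (hle : ∀ i j, A₁ i j ≤ A₂ i j) :
    (⨅ i, h₁.eigenvalues i) ≤ ⨅ i, h₂.eigenvalues i := by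
  refine le_ciInf fun i ↦ ?_
  set v : Fin (n + 1) → ℝ := (h₂.eigenvectorBasis i).ofLp with hv
  have hpos : 0 < v ⬝ᵥ v := by
    have hne : v ≠ 0 := by simpa [hv] using h₂.eigenvectorBasis.toBasis.ne_zero i
    exact Matrix.dotProduct_star_self_pos_iff.mpr hne
  have habs : |v| ⬝ᵥ |v| = v ⬝ᵥ v := by simp [dotProduct]
  have hlow := h₁.mul_dotProduct_self_le
    (fun j ↦ ciInf_le (Set.finite_range h₁.eigenvalues).bddBelow j) |v|
  have hup := Matrix.abs_dotProduct_mulVec_abs_le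
    (fun j ↦ (hd₁ j).trans (hd₂ j).symm) ho₂ hle v
  rw [h₂.mulVec_eigenvectorBasis i, dotProduct_smul, smul_eq_mul] at hup
  rw [habs] at hlow
  exact le_of_mul_le_mul_right (hlow.trans hup) hpos
end

section
/- Let n ≥ 1 and let (λ_{ij})_{0 ≤ i,j ≤ n} be a symmetric family of real numbers with 0 ≤ λ_{ij} and λ_{in} < 1 for all 0 ≤ i ≤ n−1. Let A be the (n+1)×(n+1) matrix with A_{ii} = 1 and A_{ij} = −λ_{ij} for i ≠ j, and let A' be the n×n matrix with A'_{ii} = 1 and A'_{ij} = −δ_{ij} for i ≠ j, where δ_{ij} = (λ_{ij} + λ_{in}λ_{jn}) / (√(1−λ_{in}²)·√(1−λ_{jn}²)). If A is positive definite with smallest eigenvalue μ, and μ' is the smallest eigenvalue of A', then μ ≤ μ'. In particular, if A is positive definite, then A' is also positive definite. -/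
open Matrix in
/-- The smallest eigenvalue of a real symmetric matrix bounds its Rayleigh quotients from below. -/
theorem Matrix.IsHermitian.iInf_eigenvalues_mul_dotProduct_le {ι : Type*} [Fintype ι]
    [DecidableEq ι] {A : Matrix ι ι ℝ} (hA : A.IsHermitian) (z : ι → ℝ) :
    (⨅ i, hA.eigenvalues i) * (z ⬝ᵥ z) ≤ z ⬝ᵥ A *ᵥ z := by
  set m := ⨅ i, hA.eigenvalues i
  have hps : (A - algebraMap ℝ (Matrix ι ι ℝ) m).PosSemidef := by
    rw [posSemidef_iff_isHermitian_and_spectrum_nonneg]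
    refine ⟨hA.sub ?_, fun x hx => ?_⟩
    · rw [Algebra.algebraMap_eq_smul_one]
      simp [Matrix.IsHermitian]
    · rw [← spectrum.sub_singleton_eq, hA.spectrum_real_eq_range_eigenvalues] at hx
      obtain ⟨_, ⟨i, rfl⟩, _, rfl, rfl⟩ := hx
      exact sub_nonneg.2 (ciInf_le (Set.finite_range hA.eigenvalues).bddBelow i)
  have h := hps.dotProduct_mulVec_nonneg z
  rw [Algebra.algebraMap_eq_smul_one, sub_mulVec, smul_mulVec, one_mulVec, dotProduct_sub,
    dotProduct_smul] at h
  simpa using h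

open Matrix in
/-- Eliminating the last variable of a quadratic form with matrix `A`, where `A` has last diagonal
entry `1` and last column `-l`, and rescaling the remaining variables by `s`. -/
theorem Matrix.dotProduct_mulVec_snoc_of_eq_add {n : ℕ} {A : Matrix (Fin (n + 1)) (Fin (n + 1)) ℝ}
    {B : Matrix (Fin n) (Fin n) ℝ} {s l y : Fin n → ℝ}
    (hblock : ∀ i j, A i.castSucc j.castSucc = s i * s j * B i j + l i * l j)
    (hcol : ∀ i, A i.castSucc (Fin.last n) = -l i)
    (hrow : ∀ i, A (Fin.last n) i.castSucc = -l i)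
    (hlast : A (Fin.last n) (Fin.last n) = 1) :
    (Fin.snoc y (l ⬝ᵥ y) : Fin (n + 1) → ℝ) ⬝ᵥ A *ᵥ (Fin.snoc y (l ⬝ᵥ y) : Fin (n + 1) → ℝ) =
      (s * y) ⬝ᵥ B *ᵥ (s * y) := by
  have hmul : ∀ i, ∑ j, A i.castSucc j.castSucc * y j =
      s i * ∑ j, B i j * (s j * y j) + l i * (l ⬝ᵥ y) := by
    intro i
    simp only [hblock, dotProduct, Finset.mul_sum, ← Finset.sum_add_distrib]
    exact Finset.sum_congr rfl fun j _ => by ring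
  have hlin : ∑ j, -l j * y j = -(l ⬝ᵥ y) := by simp [dotProduct]
  simp only [dotProduct, mulVec, Fin.sum_univ_castSucc, Fin.snoc_castSucc, Fin.snoc_last,
    hcol, hrow, hlast, Pi.mul_apply] at hmul hlin ⊢
  simp only [hmul, hlin]
  rw [one_mul, neg_add_cancel, mul_zero, add_zero]
  exact Finset.sum_congr rfl fun j _ => by ring


/-- Let `A` be the `(n+1)×(n+1)` matrix with `A_{ii} = 1`, `A_{ij} = -λ_{ij}` and `A'` the
`n×n` matrix with `A'_{ii} = 1`, `A'_{ij} = -δ_{ij}` where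
`δ_{ij} = (λ_{ij} + λ_{in} λ_{jn}) / (√(1-λ_{in}²) √(1-λ_{jn}²))`. If `A` is positive
definite with smallest eigenvalue `μ` and `μ'` is the smallest eigenvalue of `A'`, then
`μ ≤ μ'`; in particular `A'` is positive definite. -/
theorem smallest_eigenvalue_le_of_reduced {n : ℕ} (hn : 1 ≤ n)
    (lam : Fin (n + 1) → Fin (n + 1) → ℝ)
    (hsym : ∀ i j, lam i j = lam j i)
    (hnonneg : ∀ i j, 0 ≤ lam i j)
    (hlt : ∀ i : Fin n, lam i.castSucc (Fin.last n) < 1)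
    (A : Matrix (Fin (n + 1)) (Fin (n + 1)) ℝ)
    (hAdef : ∀ i j, A i j = if i = j then 1 else -lam i j)
    (A' : Matrix (Fin n) (Fin n) ℝ)
    (hA'def : ∀ i j : Fin n, A' i j = if i = j then 1 else
      -((lam i.castSucc j.castSucc + lam i.castSucc (Fin.last n) * lam j.castSucc (Fin.last n)) /
        (Real.sqrt (1 - lam i.castSucc (Fin.last n) ^ 2) *
          Real.sqrt (1 - lam j.castSucc (Fin.last n) ^ 2))))
    (hA : A.IsHermitian) (hA' : A'.IsHermitian) (hpd : A.PosDef) :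
    (⨅ i, hA.eigenvalues i) ≤ (⨅ i, hA'.eigenvalues i) ∧ A'.PosDef := by
  have : Nonempty (Fin n) := ⟨⟨0, hn⟩⟩
  set m := ⨅ i, hA.eigenvalues i with hm
  have hm_pos : 0 < m := by
    obtain ⟨i, hi⟩ := exists_eq_ciInf_of_finite (f := hA.eigenvalues)
    rw [hm, ← hi]
    exact hpd.eigenvalues_pos i
  set l : Fin n → ℝ := fun i => lam i.castSucc (Fin.last n)
  set s : Fin n → ℝ := fun i => Real.sqrt (1 - l i ^ 2)
  have hl_sq : ∀ i, 0 < 1 - l i ^ 2 := fun i => by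
    have h₀ : 0 ≤ l i := hnonneg _ _
    have h₁ : l i < 1 := hlt i
    nlinarith
  have hs_pos : ∀ i, 0 < s i := fun i => Real.sqrt_pos.2 (hl_sq i)
  have hs_sq : ∀ i, s i * s i = 1 - l i ^ 2 := fun i => Real.mul_self_sqrt (hl_sq i).le
  have hblock : ∀ i j, A i.castSucc j.castSucc = s i * s j * A' i j + l i * l j := by
    intro i j
    rw [hAdef, hA'def]
    by_cases hij : i = j
    · subst hij
      simp only [if_true, hs_sq]
      ring
    · have hne : s i * s j ≠ 0 := (mul_pos (hs_pos i) (hs_pos j)).ne'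
      rw [if_neg hij, if_neg (by simpa using hij)]
      change _ = s i * s j * -((_ + l i * l j) / (s i * s j)) + _
      rw [mul_neg, mul_div_cancel₀ _ hne]
      ring
  have hbound : ∀ x : Fin n → ℝ, m * (x ⬝ᵥ x) ≤ x ⬝ᵥ A'.mulVec x := by
    intro x
    set y : Fin n → ℝ := fun i => x i / s i
    have hsy : s * y = x := funext fun i => mul_div_cancel₀ (x i) (hs_pos i).ne'
    have h := hA.iInf_eigenvalues_mul_dotProduct_le (Fin.snoc y (l ⬝ᵥ y) : Fin (n + 1) → ℝ)
    rw [Matrix.dotProduct_mulVec_snoc_of_eq_add hblock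
      (fun i => by rw [hAdef, if_neg (Fin.castSucc_lt_last i).ne])
      (fun i => by rw [hAdef, if_neg (Fin.castSucc_lt_last i).ne', hsym])
      (by rw [hAdef, if_pos rfl]), hsy] at h
    refine (mul_le_mul_of_nonneg_left ?_ hm_pos.le).trans h
    simp only [dotProduct, Fin.sum_univ_castSucc, Fin.snoc_castSucc, Fin.snoc_last]
    refine le_add_of_le_of_nonneg (Finset.sum_le_sum fun i _ => ?_) (mul_self_nonneg _)
    have hxi : x i = s i * y i := (congrFun hsy i).symm
    calc x i * x i = s i * s i * (y i * y i) := by rw [hxi]; ring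
      _ ≤ 1 * (y i * y i) := by
        gcongr
        · exact mul_self_nonneg _
        · rw [hs_sq]
          linarith [sq_nonneg (l i)]
      _ = y i * y i := one_mul _
  have heig : ∀ i, m ≤ hA'.eigenvalues i := by
    intro i
    set v : Fin n → ℝ := ⇑(hA'.eigenvectorBasis i)
    have hv_ne : v ≠ 0 := fun h => hA'.eigenvectorBasis.orthonormal.ne_zero i
      (by ext j; exact congrFun h j)
    have hv_pos : 0 < v ⬝ᵥ v := by
      simpa using Matrix.dotProduct_star_self_pos_iff.2 hv_ne
    have h := hbound v
    rw [hA'.mulVec_eigenvectorBasis i, dotProduct_smul, smul_eq_mul] at h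
    exact le_of_mul_le_mul_right h hv_pos
  exact ⟨le_ciInf heig,
    hA'.posDef_iff_eigenvalues_pos.2 fun i => hm_pos.trans_le (heig i)⟩
end
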